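/- arXiv:2302.12140 — 3 statements merged into one kernel-verified Lean document; each statement's English description precedes it below -/
import Mathlib

section
/- Assume the number of voters n ≥ 4 is even, fix a preference relation ▷, and let D be a connected domain with D_C^▷ ⊊ D. An SDS on D is strategyproof and non-imposing if and only if it is a random dictatorship. -/
open scoped Classical
open Finset

/-- A preference relation: a complete, transitive, and antisymmetric binary relation. -/
def IsPref {A : Type*} (r : A → A → Prop) : Prop :=
  (∀ x y : A, x ≠ y → r x y ∨ r y x) ∧
  (∀ x y z : A, r x y → r y z → r x z) ∧
  (∀ x y : A, r x y → ¬ r y x)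

/-- A preference profile for `n` voters over alternatives `A`. -/
abbrev Prof (n : ℕ) (A : Type*) := Fin n → A → A → Prop

/-- Every voter's relation is a preference relation. -/
def IsProf {n : ℕ} {A : Type*} (R : Prof n A) : Prop := ∀ i, IsPref (R i)

/-- The majority margin `g_R(x,y)`. -/
noncomputable def margin {n : ℕ} {A : Type*} (R : Prof n A) (x y : A) : ℤ :=
  (Nat.card {i : Fin n // R i x y} : ℤ) - (Nat.card {i : Fin n // R i y x} : ℤ)

/-- `x` is the Condorcet winner of `R`. -/
def CondorcetWinner {n : ℕ} {A : Type*} (R : Prof n A) (x : A) : Prop :=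
  ∀ y, y ≠ x → 0 < margin R x y

/-- The Condorcet domain: all profiles admitting a Condorcet winner. -/
def CondorcetDomain (n : ℕ) (A : Type*) : Set (Prof n A) :=
  {R | IsProf R ∧ ∃ x, CondorcetWinner R x}

/-- The `(n+1)`-voter profile `(R, ▷)` obtained from `R` by adding `t` as an extra voter. -/
def tieProf {n : ℕ} {A : Type*} (R : Prof n A) (t : A → A → Prop) : Prof (n + 1) A :=
  Fin.cons t R

/-- The tie-breaking Condorcet domain `D_C^▷`. -/
def TieCondorcetDomain (n : ℕ) {A : Type*} (t : A → A → Prop) : Set (Prof n A) :=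
  {R | IsProf R ∧ ∃ x, CondorcetWinner (tieProf R t) x}

/-- Upper contour set `U(≻, x)`. -/
def UC {A : Type*} (r : A → A → Prop) (x : A) : Set A := {y | r y x ∨ y = x}

/-- Probability that the lottery `p` assigns to the set `S`. -/
noncomputable def mass {A : Type*} [Fintype A] (p : A → ℝ) (S : Set A) : ℝ :=
  ∑ y, S.indicator p y

/-- Stochastic dominance `p ≿^SD q` w.r.t. the preference relation `r`. -/
def SDdom {A : Type*} [Fintype A] (r : A → A → Prop) (p q : A → ℝ) : Prop :=
  ∀ x, mass q (UC r x) ≤ mass p (UC r x)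

/-- `f` is a social decision scheme on the domain `D`: on `D` it returns lotteries. -/
def IsSDS {n : ℕ} {A : Type*} [Fintype A] (D : Set (Prof n A))
    (f : Prof n A → A → ℝ) : Prop :=
  ∀ R ∈ D, (∀ x, 0 ≤ f R x) ∧ (∑ x, f R x) = 1

/-- Strategyproofness of `f` on `D`. -/
def Strategyproof {n : ℕ} {A : Type*} [Fintype A] (D : Set (Prof n A))
    (f : Prof n A → A → ℝ) : Prop :=
  ∀ R ∈ D, ∀ R' ∈ D, ∀ i : Fin n,
    (∀ j, j ≠ i → R j = R' j) → SDdom (R i) (f R) (f R')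

/-- Group-strategyproofness of `f` on `D`. -/
def GroupStrategyproof {n : ℕ} {A : Type*} [Fintype A] (D : Set (Prof n A))
    (f : Prof n A → A → ℝ) : Prop :=
  ∀ R ∈ D, ∀ R' ∈ D, ∀ I : Finset (Fin n), I.Nonempty →
    (∀ j ∉ I, R j = R' j) → ∃ i ∈ I, SDdom (R i) (f R) (f R')

/-- Non-imposition of `f` on `D`. -/
def NonImposing {n : ℕ} {A : Type*} [Fintype A] (D : Set (Prof n A))
    (f : Prof n A → A → ℝ) : Prop :=
  ∀ x : A, ∃ R ∈ D, f R x = 1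

/-- Ex post efficiency of `f` on `D`. -/
def ExPostEfficient {n : ℕ} {A : Type*} [Fintype A] (D : Set (Prof n A))
    (f : Prof n A → A → ℝ) : Prop :=
  ∀ R ∈ D, ∀ x y : A, (∀ i, R i x y) → f R y = 0

/-- `x` is top-ranked by the preference relation `r`. -/
def TopRanked {A : Type*} (r : A → A → Prop) (x : A) : Prop := ∀ y, y ≠ x → r x y

/-- The dictatorship of voter `i`. -/
noncomputable def dict {n : ℕ} {A : Type*} [Fintype A] (i : Fin n) (R : Prof n A) : A → ℝ :=
  fun x => if TopRanked (R i) x then 1 else 0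

/-- The Condorcet rule `COND`. -/
noncomputable def CondRule {n : ℕ} {A : Type*} [Fintype A] : Prof n A → A → ℝ :=
  fun R x => if CondorcetWinner R x then 1 else 0

/-- The tie-breaking Condorcet rule `COND^▷`. -/
noncomputable def TieCondRule {n : ℕ} {A : Type*} [Fintype A] (t : A → A → Prop) :
    Prof n A → A → ℝ :=
  fun R x => if CondorcetWinner (tieProf R t) x then 1 else 0

/-- The relation obtained from `r` by swapping the (adjacent) alternatives `x ≻ y`. -/
def swapRel {A : Type*} (r : A → A → Prop) (x y : A) : A → A → Prop :=
  fun a b => (a = y ∧ b = x) ∨ (r a b ∧ ¬(a = x ∧ b = y))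

/-- `R'` arises from `R` by letting voter `i` swap the adjacent alternatives `x ≻_i y`,
i.e., `R' = R^{i:yx}`. -/
def AdjSwap {n : ℕ} {A : Type*} (R R' : Prof n A) (i : Fin n) (x y : A) : Prop :=
  x ≠ y ∧ R i x y ∧ (∀ z, z ≠ x → z ≠ y → ¬(R i x z ∧ R i z y)) ∧
  R' i = swapRel (R i) x y ∧ (∀ j, j ≠ i → R' j = R j)

/-- A single ad-path step inside `D`. -/
def Step {n : ℕ} {A : Type*} (D : Set (Prof n A)) (R R' : Prof n A) : Prop :=
  R ∈ D ∧ R' ∈ D ∧ ∃ i x y, AdjSwap R R' i x y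

/-- A single ad-path step inside `D` in which the alternative `a` is not swapped. -/
def StepAvoiding {n : ℕ} {A : Type*} (D : Set (Prof n A)) (a : A) (R R' : Prof n A) : Prop :=
  R ∈ D ∧ R' ∈ D ∧ ∃ i x y, AdjSwap R R' i x y ∧ x ≠ a ∧ y ≠ a

/-- There is an ad-path from `R` to `R'` inside `D`. -/
def AdPath {n : ℕ} {A : Type*} (D : Set (Prof n A)) (R R' : Prof n A) : Prop :=
  R ∈ D ∧ R' ∈ D ∧ Relation.ReflTransGen (Step D) R R'

/-- There is an ad-path from `R` to `R'` inside `D` along which `a` is never swapped. -/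
def AdPathAvoiding {n : ℕ} {A : Type*} (D : Set (Prof n A)) (a : A) (R R' : Prof n A) : Prop :=
  R ∈ D ∧ R' ∈ D ∧ Relation.ReflTransGen (StepAvoiding D a) R R'

/-- `D` is weakly connected. -/
def WeaklyConnected {n : ℕ} {A : Type*} (D : Set (Prof n A)) : Prop :=
  ∀ R ∈ D, ∀ R' ∈ D, AdPath D R R'

/-- `D` is connected. -/
def Connected {n : ℕ} {A : Type*} (D : Set (Prof n A)) : Prop :=
  WeaklyConnected D ∧
  ∀ a : A, ∀ R ∈ D, ∀ R' ∈ D, (∀ i, UC (R i) a = UC (R' i) a) → AdPathAvoiding D a R R'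

section Preferences

variable {A : Type*}

/-- Move `a` to the top of `r`. -/
def raise (a : A) (r : A → A → Prop) : A → A → Prop :=
  fun x y => y ≠ a ∧ (x = a ∨ r x y)

/-- Move `a` to the bottom of `r`. -/
def lower (a : A) (r : A → A → Prop) : A → A → Prop :=
  fun x y => x ≠ a ∧ (y = a ∨ r x y)

/-- Order by the key `k` first, and by `r` among alternatives with equal keys. -/
def lexPref (k : A → ℕ) (r : A → A → Prop) : A → A → Prop :=
  fun x y => k x < k y ∨ (k x = k y ∧ r x y)

theorem IsPref.irrefl {r : A → A → Prop} (hr : IsPref r) (x : A) : ¬ r x x :=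
  fun h => hr.2.2 x x h h

theorem IsPref.ne {r : A → A → Prop} (hr : IsPref r) {x y : A} (h : r x y) : x ≠ y := by
  rintro rfl
  exact hr.irrefl x h

theorem IsPref.not_iff {r : A → A → Prop} (hr : IsPref r) {x y : A} (h : x ≠ y) :
    ¬ r x y ↔ r y x :=
  ⟨fun h' => (hr.1 x y h).resolve_left h', fun h' => hr.2.2 y x h'⟩

theorem IsPref.topRanked_iff {r : A → A → Prop} (hr : IsPref r) {x : A} :
    TopRanked r x ↔ ∀ y, ¬ r y x := by
  refine ⟨fun h y hy => hr.2.2 _ _ hy (h y (hr.ne hy)), fun h y hy => ?_⟩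
  exact (hr.not_iff hy).1 (h y)

theorem IsPref.lexPref {r : A → A → Prop} (hr : IsPref r) (k : A → ℕ) :
    IsPref (lexPref k r) := by
  refine ⟨fun x y h => ?_, fun x y z h₁ h₂ => ?_, fun x y h₁ h₂ => ?_⟩
  · rcases lt_trichotomy (k x) (k y) with h' | h' | h'
    · exact Or.inl (Or.inl h')
    · rcases hr.1 x y h with h'' | h''
      · exact Or.inl (Or.inr ⟨h', h''⟩)
      · exact Or.inr (Or.inr ⟨h'.symm, h''⟩)
    · exact Or.inr (Or.inl h')
  · rcases h₁ with h₁ | ⟨h₁, h₁'⟩ <;> rcases h₂ with h₂ | ⟨h₂, h₂'⟩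
    · exact Or.inl (h₁.trans h₂)
    · exact Or.inl (h₂ ▸ h₁)
    · exact Or.inl (h₁ ▸ h₂)
    · exact Or.inr ⟨h₁.trans h₂, hr.2.1 _ _ _ h₁' h₂'⟩
  · rcases h₁ with h₁ | ⟨h₁, h₁'⟩ <;> rcases h₂ with h₂ | ⟨h₂, h₂'⟩
    · omega
    · omega
    · omega
    · exact hr.2.2 _ _ h₁' h₂'

theorem IsPref.raise {r : A → A → Prop} (hr : IsPref r) (a : A) : IsPref (raise a r) := by
  have h : _root_.raise a r = _root_.lexPref (fun z => if z = a then 0 else 1) r := by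
    funext x y
    have := hr.irrefl a
    by_cases hx : x = a <;> by_cases hy : y = a <;> simp_all [_root_.raise, _root_.lexPref]
  exact h ▸ hr.lexPref _

theorem IsPref.lower {r : A → A → Prop} (hr : IsPref r) (a : A) : IsPref (lower a r) := by
  have h : _root_.lower a r = _root_.lexPref (fun z => if z = a then 1 else 0) r := by
    funext x y
    have := hr.irrefl a
    by_cases hx : x = a <;> by_cases hy : y = a <;> simp_all [_root_.lower, _root_.lexPref]
  exact h ▸ hr.lexPref _

theorem IsPref.exists_top {r : A → A → Prop} (hr : IsPref r) (S : Finset A)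
    (hS : S.Nonempty) : ∃ y ∈ S, ∀ z ∈ S, z ≠ y → r y z := by
  induction hS using Finset.Nonempty.cons_induction with
  | singleton a => exact ⟨a, by simp, by simp⟩
  | cons a S ha hS ih =>
    obtain ⟨y, hy, h⟩ := ih
    have hay : a ≠ y := fun h => ha (h ▸ hy)
    rcases hr.1 a y hay with h' | h'
    · refine ⟨a, by simp, fun z hz hza => ?_⟩
      have hz : z ∈ S := by simpa [hza] using hz
      by_cases hzy : z = y
      · exact hzy ▸ h'
      · exact hr.2.1 _ _ _ h' (h z hz hzy)
    · refine ⟨y, by simp [hy], fun z hz hzy => ?_⟩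
      rcases Finset.mem_cons.1 hz with rfl | hz
      · exact h'
      · exact h z hz hzy

theorem IsPref.flip {r : A → A → Prop} (hr : IsPref r) : IsPref (fun x y => r y x) :=
  ⟨fun x y h => (hr.1 x y h).symm, fun _ _ _ h₁ h₂ => hr.2.1 _ _ _ h₂ h₁,
    fun _ _ h => hr.2.2 _ _ h⟩

theorem IsPref.exists_topRanked [Fintype A] [Nonempty A] {r : A → A → Prop} (hr : IsPref r) :
    ∃ y, TopRanked r y := by
  obtain ⟨y, -, h⟩ := hr.exists_top univ univ_nonempty
  exact ⟨y, fun z hz => h z (mem_univ _) hz⟩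

theorem IsPref.upper_eq [Fintype A] {r : A → A → Prop} (hr : IsPref r) (B : Set A)
    (hB : ∀ y ∈ B, ∀ z, r z y → z ∈ B) : B = ∅ ∨ ∃ y, B = UC r y := by
  rcases B.eq_empty_or_nonempty with h | h
  · exact Or.inl h
  · right
    obtain ⟨y, hy, h'⟩ := hr.flip.exists_top B.toFinset (by simpa using h)
    rw [Set.mem_toFinset] at hy
    refine ⟨y, Set.ext fun z => ⟨fun hz => ?_, ?_⟩⟩
    · by_cases hzy : z = y
      · exact Or.inr hzy
      · exact Or.inl (h' z (by simpa using hz) hzy)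
    · rintro (hz | rfl)
      · exact hB y hy z hz
      · exact hy

end Preferences

section Mass

variable {A : Type*} [Fintype A]

theorem mass_empty (p : A → ℝ) : mass p ∅ = 0 := by simp [mass]

theorem mass_UC {r : A → A → Prop} (hr : IsPref r) (p : A → ℝ) (x : A) :
    mass p (UC r x) = mass p {y | r y x} + p x := by
  have h : ∀ y, (UC r x).indicator p y =
      ({y | r y x} : Set A).indicator p y + (if y = x then p y else 0) := by
    intro y
    by_cases hy : y = x
    · subst hy
      simp [UC, hr.irrefl, Set.indicator]
    · simp [UC, hy, Set.indicator]
  simp [mass, h, Finset.sum_add_distrib]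

theorem SDdom.mass_le {r : A → A → Prop} (hr : IsPref r) {p q : A → ℝ} (h : SDdom r p q)
    (B : Set A) (hB : ∀ y ∈ B, ∀ z, r z y → z ∈ B) : mass q B ≤ mass p B := by
  rcases hr.upper_eq B hB with rfl | ⟨y, rfl⟩
  · simp [mass_empty]
  · exact h y

end Mass

section Majorities

variable {n : ℕ} {A : Type*}

/-- If exactly the voters in `S` prefer `a` to `b`, then `b` beats `a` after breaking ties
by `t`. -/
def Weak (t : A → A → Prop) (S : Finset (Fin n)) (a b : A) : Prop :=
  2 * #S < n ∨ (2 * #S = n ∧ t b a)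

/-- `c` beats every other alternative after breaking ties by `t`. -/
def Wins (t : A → A → Prop) (R : Prof n A) (c : A) : Prop :=
  ∀ z, z ≠ c → Weak t {i | R i z c} z c

theorem Weak.mono {t : A → A → Prop} {S T : Finset (Fin n)} {a b : A} (h : Weak t S a b)
    (hT : T ⊆ S) : Weak t T a b := by
  have := Finset.card_le_card hT
  rcases h with h | ⟨h, h'⟩
  · exact Or.inl (by omega)
  · by_cases h₂ : 2 * #T < n
    · exact Or.inl h₂
    · exact Or.inr ⟨by omega, h'⟩

theorem weak_or_weak_compl {t : A → A → Prop} (ht : IsPref t) (S : Finset (Fin n)) {a b : A}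
    (hab : a ≠ b) : Weak t S a b ∨ Weak t Sᶜ b a := by
  have h : #S + #Sᶜ = n := by simp
  unfold Weak
  rcases lt_trichotomy (2 * #S) n with h' | h' | h'
  · exact Or.inl (Or.inl h')
  · rcases ht.1 a b hab with h'' | h''
    · exact Or.inr (Or.inr ⟨by omega, h''⟩)
    · exact Or.inl (Or.inr ⟨h', h''⟩)
  · exact Or.inr (Or.inl (by omega))

theorem not_weak_compl {t : A → A → Prop} (ht : IsPref t) {S : Finset (Fin n)} {a b : A}
    (h : Weak t S a b) : ¬ Weak t Sᶜ b a := by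
  have h' : #S + #Sᶜ = n := by simp
  rintro (h₂ | ⟨h₂, h₃⟩) <;> rcases h with h | ⟨h, h₁⟩
  · omega
  · omega
  · omega
  · exact ht.2.2 _ _ h₁ h₃

theorem Wins.of_imp {t : A → A → Prop} {R R' : Prof n A} {c : A} (h : Wins t R c)
    (hR : ∀ i z, z ≠ c → R' i z c → R i z c) : Wins t R' c := fun z hz =>
  (h z hz).mono fun i => by simpa using hR i z hz

theorem wins_iff {t : A → A → Prop} (heven : Even n) (ht : IsPref t) {R : Prof n A}
    (hR : IsProf R) (c : A) : CondorcetWinner (tieProf R t) c ↔ Wins t R c := by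
  refine forall_congr' fun z => forall_congr' fun hz => ?_
  obtain ⟨q, rfl⟩ := heven
  have key : ∀ x y : A, Nat.card {i : Fin (q + q + 1) // tieProf R t i x y} =
      (if t x y then 1 else 0) + #({i | R i x y} : Finset (Fin (q + q))) := by
    intro x y
    rw [Nat.card_eq_fintype_card, Fintype.card_subtype, Fin.card_filter_univ_succ]
    simp only [tieProf, Fin.cons_zero, Fin.cons_succ]
    split_ifs <;> omega
  have hcompl : #({i | R i c z} : Finset (Fin (q + q))) +
      #({i | R i z c} : Finset (Fin (q + q))) = q + q := by
    have h : ({i | R i z c} : Finset (Fin (q + q))) = ({i | R i c z} : Finset _)ᶜ := by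
      ext i
      simp [(hR i).not_iff hz.symm]
    rw [h]
    simpa using Finset.card_add_card_compl ({i | R i c z} : Finset (Fin (q + q)))
  unfold margin
  rw [key, key]
  unfold Weak
  by_cases h : t c z
  · have h' : ¬ t z c := ht.2.2 _ _ h
    simp only [h, h', if_true, if_false, and_true]
    omega
  · have h' : t z c := (ht.not_iff hz.symm).1 h
    simp only [h, h', if_true, if_false, and_false, or_false]
    omega

theorem Wins.unique {t : A → A → Prop} (ht : IsPref t) {R : Prof n A} (hR : IsProf R) {c z : A}
    (hc : Wins t R c) (hz : Wins t R z) : z = c := by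
  by_contra h
  have h' : ({i | R i c z} : Finset (Fin n)) = ({i | R i z c} : Finset _)ᶜ := by
    ext i
    simp [(hR i).not_iff h]
  exact not_weak_compl ht (hc z h) (h' ▸ hz c (Ne.symm h))

theorem exists_wins_same_upper [Fintype A] {t : A → A → Prop} (ht : IsPref t) {R : Prof n A}
    (hR : IsProf R) (x : A) :
    ∃ R' : Prof n A, IsProf R' ∧ (∃ c, Wins t R' c) ∧ ∀ i y, R' i y x ↔ R i y x := by
  by_cases hx : Wins t R x
  · exact ⟨R, hR, ⟨x, hx⟩, fun _ _ => Iff.rfl⟩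
  unfold Wins at hx
  push Not at hx
  obtain ⟨v, hvx, hv⟩ := hx
  set N : A → Finset (Fin n) := fun z => {i | R i z x} with hN
  have hNn : ∀ z, #(N z) ≤ n := fun z => by simpa using Finset.card_le_univ (N z)
  obtain ⟨y, hy, hmax⟩ := (ht.lexPref fun z => n - #(N z)).exists_top (univ.erase x)
    ⟨v, by simp [hvx]⟩
  have hyx : y ≠ x := by simpa using hy
  replace hmax : ∀ z, z ≠ x → z ≠ y → #(N z) < #(N y) ∨ (#(N z) = #(N y) ∧ t y z) := by
    intro z hzx hzy
    have h₁ := hNn z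
    have h₂ := hNn y
    rcases hmax z (by simp [hzx]) hzy with h | ⟨h, h'⟩
    · exact Or.inl (by simp only at h; omega)
    · exact Or.inr ⟨by simp only at h; omega, h'⟩
  let k : Fin n → A → ℕ := fun i z =>
    if R i z x then (if z = y then 0 else 1) else if z = x then 2 else if z = y then 3 else 4
  have hxx : ∀ i, ¬ R i x x := fun i => (hR i).irrefl x
  refine ⟨fun i => lexPref (k i) (R i), fun i => (hR i).lexPref _, ⟨y, fun z hzy => ?_⟩, ?_⟩
  · by_cases hzx : z = x
    · subst hzx
      have hset : ({i | lexPref (k i) (R i) z y} : Finset (Fin n)) ⊆ (N y)ᶜ := by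
        intro i
        by_cases h : R i y z <;> simp [lexPref, k, h, hxx, hyx, hN]
      refine Weak.mono ?_ hset
      have hc : #(N y) + #(N y)ᶜ = n := by simp
      unfold Weak at hv ⊢
      push Not at hv
      have hle : #(N v) < #(N y) ∨ (#(N v) = #(N y) ∧ (v = y ∨ t y v)) := by
        by_cases h : v = y
        · exact Or.inr ⟨by rw [h], Or.inl h⟩
        · exact (hmax v hvx h).imp id fun h' => ⟨h'.1, Or.inr h'.2⟩
      by_cases h2 : 2 * #(N y)ᶜ < n
      · exact Or.inl h2
      · have h3 : 2 * #(N v) = n := by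
          have := hv.1
          change n ≤ 2 * #(N v) at this
          omega
        have h4 : t v z := (ht.not_iff hvx.symm).1 (hv.2 h3)
        refine Or.inr ⟨by omega, ?_⟩
        rcases hle with h5 | ⟨-, rfl | h5⟩
        · omega
        · exact h4
        · exact ht.2.1 _ _ _ h5 h4
    · have hset : ({i | lexPref (k i) (R i) z y} : Finset (Fin n)) ⊆ N z \ N y := by
        intro i
        by_cases h : R i y x <;> by_cases h' : R i z x <;>
          simp [lexPref, k, h, h', hyx, hzx, hN, hzy]
      refine Weak.mono ?_ hset
      have h₁ := Finset.card_sdiff_add_card_inter (N z) (N y)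
      have h₂ := Finset.card_sdiff_add_card_inter (N y) (N z)
      rw [Finset.inter_comm] at h₂
      have h₃ : #(N z \ N y) + #(N y \ N z) ≤ n := by
        rw [← Finset.card_union_of_disjoint disjoint_sdiff_sdiff]
        simpa using Finset.card_le_univ (N z \ N y ∪ N y \ N z)
      unfold Weak
      rcases hmax z hzx hzy with h | ⟨h, h'⟩
      · exact Or.inl (by omega)
      · by_cases h2 : 2 * #(N z \ N y) < n
        · exact Or.inl h2
        · exact Or.inr ⟨by omega, h'⟩
  · intro i z
    by_cases hzx : z = x
    · subst hzx
      simp [lexPref, hxx]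
    · by_cases h : R i z x <;> by_cases h' : z = y <;> simp [lexPref, k, h, h', hxx, hyx, hzx]
      · grind
      all_goals grind

end Majorities

section Dictatorships

variable {n : ℕ} {A : Type*} [Fintype A]

theorem sum_mul_dict (γ : Fin n → ℝ) (R : Prof n A) (x : A) :
    ∑ i, γ i * dict i R x = ∑ i ∈ {i | TopRanked (R i) x}, γ i := by
  simp [dict, Finset.sum_filter]

theorem sum_dict [Nonempty A] {R : Prof n A} (hR : IsProf R) (i : Fin n) :
    ∑ x, dict i R x = 1 := by
  obtain ⟨y, hy⟩ := (hR i).exists_topRanked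
  have h : ∀ x, TopRanked (R i) x ↔ x = y := fun x => by
    refine ⟨fun hx => ?_, fun h => h ▸ hy⟩
    by_contra hxy
    exact (hR i).2.2 _ _ (hy x hxy) (hx y (Ne.symm hxy))
  simp [dict, h]

theorem sum_sum_mul_dict [Nonempty A] (γ : Fin n → ℝ) {R : Prof n A} (hR : IsProf R) :
    ∑ x, ∑ i, γ i * dict i R x = ∑ i, γ i := by
  rw [Finset.sum_comm]
  simp [← Finset.mul_sum, sum_dict hR]

end Dictatorships

section Hybrid

variable {n : ℕ} {A : Type*}

/-- The profile in which the voters in `S` report as in `R'` and the others as in `R`. -/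
def hybrid (S : Finset (Fin n)) (R R' : Prof n A) : Prof n A :=
  fun i => if i ∈ S then R' i else R i

theorem IsProf.hybrid {R R' : Prof n A} (hR : IsProf R) (hR' : IsProf R')
    (S : Finset (Fin n)) : IsProf (hybrid S R R') := by
  intro i
  unfold _root_.hybrid
  split_ifs
  exacts [hR' i, hR i]

theorem Wins.hybrid {t : A → A → Prop} {R R' : Prof n A} {c : A} (h : Wins t R c)
    (hR : ∀ i z, z ≠ c → R' i z c → R i z c) (S : Finset (Fin n)) :
    Wins t (hybrid S R R') c := by
  refine h.of_imp fun i z hz => ?_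
  unfold _root_.hybrid
  split_ifs
  exacts [hR i z hz, id]

theorem hybrid_empty (R R' : Prof n A) : hybrid ∅ R R' = R := by
  funext i
  simp [hybrid]

theorem hybrid_univ (R R' : Prof n A) : hybrid univ R R' = R' := by
  funext i
  simp [hybrid]

theorem hybrid_compl (S : Finset (Fin n)) (R R' : Prof n A) :
    hybrid Sᶜ R R' = hybrid S R' R := by
  funext i
  by_cases h : i ∈ S <;> simp [hybrid, h]

/-- The profile in which the voters in `I` report `a, b, …` and the others `b, a, …`. -/
def pairProf (t : A → A → Prop) (I : Finset (Fin n)) (a b : A) : Prof n A :=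
  fun i => if i ∈ I then raise a (raise b t) else raise b (raise a t)

/-- The probability of `a` when the voters in `I` report `a, b, …` and the others
`b, a, …`. -/
def pairProb (f : Prof n A → A → ℝ) (t : A → A → Prop) (I : Finset (Fin n)) (a b : A) : ℝ :=
  f (pairProf t I a b) a

end Hybrid

/-- A strategyproof and non-imposing social decision scheme on a connected domain that
contains the tie-breaking Condorcet domain. -/
structure Setting {n : ℕ} {A : Type*} [Fintype A] (t : A → A → Prop) (D : Set (Prof n A))
    (f : Prof n A → A → ℝ) : Prop where
  four_le : 4 ≤ n
  even : Even n
  three_le : 3 ≤ Fintype.card A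
  tie : IsPref t
  isProf : ∀ R ∈ D, IsProf R
  sub : TieCondorcetDomain n t ⊆ D
  conn : Connected D
  sds : IsSDS D f
  sp : Strategyproof D f
  nonImposing : NonImposing D f

namespace Setting

variable {n : ℕ} {A : Type*} [Fintype A] {t : A → A → Prop} {D : Set (Prof n A)}
  {f : Prof n A → A → ℝ}

theorem mem (h : Setting t D f) {R : Prof n A} (hR : IsProf R) {c : A} (hc : Wins t R c) :
    R ∈ D :=
  h.sub ⟨hR, c, (wins_iff h.even h.tie hR c).2 hc⟩

theorem mono_single (h : Setting t D f) {R R' : Prof n A} (hR : R ∈ D) (hR' : R' ∈ D)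
    (i : Fin n) (hi : ∀ j, j ≠ i → R j = R' j) {x : A}
    (hx : ∀ y z, R' i y x → R i z y → R' i z x) : f R x ≤ f R' x := by
  have h₁ := (h.sp R hR R' hR' i hi).mass_le (h.isProf R hR i) {y | R' i y x} fun y hy z => hx y z hy
  have h₂ := h.sp R' hR' R hR i (fun j hj => (hi j hj).symm) x
  rw [mass_UC (h.isProf R' hR' i), mass_UC (h.isProf R' hR' i)] at h₂
  linarith

theorem mono (h : Setting t D f) {R R' : Prof n A} {x : A}
    (hD : ∀ S, hybrid S R R' ∈ D) (hx : ∀ i y z, R' i y x → R i z y → R' i z x) :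
    f R x ≤ f R' x := by
  have key : ∀ S, f R x ≤ f (hybrid S R R') x := by
    intro S
    induction S using Finset.induction_on with
    | empty => rw [hybrid_empty]
    | insert i S hi ih =>
      refine ih.trans (h.mono_single (hD _) (hD _) i (fun j hj => ?_) ?_)
      · simp [hybrid, hj]
      · simpa [hybrid, hi] using hx i
  simpa only [hybrid_univ] using key univ

theorem eq_of_upper (h : Setting t D f) {R R' : Prof n A} (hR : R ∈ D) (hR' : R' ∈ D) {x : A}
    (hx : ∀ i y, R i y x ↔ R' i y x) : f R x = f R' x := by
  obtain ⟨-, -, hpath⟩ := h.conn.2 x R hR R' hR' fun i => by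
    ext y
    simp [UC, hx]
  clear hx hR'
  induction hpath with
  | refl => rfl
  | @tail P Q _ hstep ih =>
    rw [ih]
    obtain ⟨hP, hQ, i, u, v, ⟨-, huv, -, hQi, hj⟩, hu, hv⟩ := hstep
    have hup : ∀ y, Q i y x ↔ P i y x := fun y => by
      simp [hQi, swapRel, hu.symm, hv.symm]
    apply le_antisymm
    · refine h.mono_single hP hQ i (fun j hji => (hj j hji).symm) fun y z hy hz => ?_
      rw [hup] at hy ⊢
      exact (h.isProf P hP i).2.1 _ _ _ hz hy
    · refine h.mono_single hQ hP i hj fun y z hy hz => ?_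
      rw [← hup] at hy ⊢
      exact (h.isProf Q hQ i).2.1 _ _ _ hz hy

theorem weak_empty (h : Setting t D f) (a b : A) : Weak t (∅ : Finset (Fin n)) a b :=
  Or.inl (by have := h.four_le; simp; omega)

theorem wins_of_top (h : Setting t D f) {R : Prof n A} {x : A} (hx : ∀ i y, ¬ R i y x) :
    Wins t R x := fun z _ => by
  simpa [hx] using h.weak_empty z x

theorem le_one (h : Setting t D f) {R : Prof n A} (hR : R ∈ D) (x : A) : f R x ≤ 1 := by
  rw [← (h.sds R hR).2]
  exact Finset.single_le_sum (fun y _ => (h.sds R hR).1 y) (mem_univ x)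

theorem mem_of_two_top (h : Setting t D f) {R : Prof n A} (hR : IsProf R) {a b : A}
    (hab : a ≠ b) (hz : ∀ i z, z ≠ a → z ≠ b → ¬ R i z a ∧ ¬ R i z b) : R ∈ D := by
  rcases weak_or_weak_compl h.tie ({i | R i a b} : Finset (Fin n)) hab with hw | hw
  · refine h.mem hR (c := b) fun z hzb => ?_
    by_cases hza : z = a
    · exact hza ▸ hw
    · simpa [hz _ z hza hzb] using h.weak_empty z b
  · refine h.mem hR (c := a) fun z hza => ?_
    by_cases hzb : z = b
    · subst hzb
      refine hw.mono fun i => ?_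
      simpa using fun hi => (hR i).2.2 _ _ hi
    · simpa [hz _ z hza hzb] using h.weak_empty z a

theorem exists_unanimous (h : Setting t D f) (x : A) :
    ∃ R ∈ D, (∀ i y, ¬ R i y x) ∧ f R x = 1 := by
  obtain ⟨P, hPD, hP1⟩ := h.nonImposing x
  obtain ⟨R, hR, ⟨c, hc⟩, hup⟩ := exists_wins_same_upper h.tie (h.isProf P hPD) x
  have hRD := h.mem hR hc
  rw [← h.eq_of_upper hRD hPD hup] at hP1
  by_cases hcx : c = x
  · subst hcx
    have hR' : IsProf fun i => raise c (R i) := fun i => (hR i).raise c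
    have hmem : (fun i => raise c (R i)) ∈ D :=
      h.mem hR' (h.wins_of_top (x := c) fun i y => by simp [raise])
    refine ⟨_, hmem, fun i y => by simp [raise], le_antisymm (h.le_one hmem _) ?_⟩
    rw [← hP1]
    refine h.mono (fun S => h.mem (hR.hybrid hR' S) (hc.hybrid (by simp [raise]) S)) ?_
    simp [raise]
  · let R₁ : Prof n A := fun i => if R i c x then raise c (R i) else raise x (raise c (R i))
    let R₂ : Prof n A := fun i =>
      if R i c x then raise c (raise x (R i)) else raise x (raise c (R i))
    let R₃ : Prof n A := fun i => raise x (raise c (R i))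
    have hR₁ : IsProf R₁ := fun i => by
      dsimp only [R₁]; split_ifs <;> simp [IsPref.raise, hR i]
    have hR₂ : IsProf R₂ := fun i => by
      dsimp only [R₂]; split_ifs <;> simp [IsPref.raise, hR i]
    have hR₃ : IsProf R₃ := fun i => by simp [R₃, IsPref.raise, hR i]
    have hne := fun i => (hR i).not_iff hcx
    have hc₁ : ∀ i z, z ≠ c → R₁ i z c → R i z c := by
      intro i z hz
      by_cases hi : R i c x
      · simp [R₁, hi, raise]
      · simp only [R₁, hi, raise, if_false]
        grind
    have hw₁ : Wins t R₁ c := hc.of_imp hc₁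
    have h01 : f R x ≤ f R₁ x := by
      refine h.mono (fun S => h.mem (hR.hybrid hR₁ S) (hc.hybrid hc₁ S)) fun i y z => ?_
      by_cases hi : R i c x
      · simp only [R₁, hi, raise, if_true]
        have := (hR i).2.1 z y x
        have := (hR i).irrefl x
        grind
      · simp [R₁, hi, raise]
    have hc₂ : ∀ i z, z ≠ c → R₂ i z c → R₁ i z c := by
      intro i z hz
      by_cases hi : R i c x <;> simp [R₁, R₂, hi, raise]
    have h12 : f R₁ x ≤ f R₂ x := by
      refine h.mono (fun S => h.mem (hR₁.hybrid hR₂ S) (hw₁.hybrid hc₂ S)) fun i y z => ?_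
      by_cases hi : R i c x <;> simp only [R₁, R₂, hi, raise, if_true, if_false] <;> grind
    have h23 : f R₂ x ≤ f R₃ x := by
      refine h.mono (fun S => h.mem_of_two_top (hR₂.hybrid hR₃ S) hcx fun i z hz hzx => ?_)
        fun i y z => by simp [R₃, raise]
      by_cases hi : R i c x <;> by_cases hS : i ∈ S <;>
        simp [hybrid, R₂, R₃, hi, hS, raise, hz, hzx]
    have hmem : R₃ ∈ D := h.mem hR₃ (h.wins_of_top (x := x) fun i y => by simp [R₃, raise])
    exact ⟨R₃, hmem, fun i y => by simp [R₃, raise],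
      le_antisymm (h.le_one hmem _) (by linarith)⟩

theorem eq_one_of_top (h : Setting t D f) {R : Prof n A} (hR : R ∈ D) {x : A}
    (hx : ∀ i y, ¬ R i y x) : f R x = 1 := by
  obtain ⟨P, hP, hPx, h1⟩ := h.exists_unanimous x
  rw [← h1]
  exact h.eq_of_upper hR hP fun i y => by simp [hx, hPx]

theorem eq_zero_of_dominated (h : Setting t D f) {R : Prof n A} (hR : R ∈ D) {x y : A}
    (hxy : ∀ i, R i x y) : f R y = 0 := by
  have hRp := h.isProf R hR
  have hR' : IsProf fun i => raise x (R i) := fun i => (hRp i).raise x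
  have hx : ∀ i z, ¬ raise x (R i) z x := fun i z => by simp [raise]
  have hmem := h.mem hR' (h.wins_of_top hx)
  have hne : y ≠ x := ((hRp ⟨0, by have := h.four_le; omega⟩).ne (hxy _)).symm
  have h1 := h.eq_one_of_top hmem hx
  have hsum := (h.sds _ hmem).2
  have h0 := (h.sds _ hmem).1
  rw [h.eq_of_upper hR hmem (x := y) fun i z => by
    simp only [raise]
    have := hxy i
    grind]
  have : ∑ z ∈ {y, x}, f (fun i => raise x (R i)) z ≤ 1 := by
    rw [← hsum]
    exact Finset.sum_le_sum_of_subset_of_nonneg (Finset.subset_univ _) fun z _ _ => h0 z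
  rw [Finset.sum_pair hne] at this
  linarith [h0 y]

theorem sum_eq_one (h : Setting t D f) {R : Prof n A} (hR : R ∈ D) (T : Finset A)
    (hT : ∀ z ∉ T, ∃ y, ∀ i, R i y z) : ∑ z ∈ T, f R z = 1 := by
  rw [← (h.sds R hR).2]
  refine Finset.sum_subset (Finset.subset_univ _) fun z _ hz => ?_
  obtain ⟨y, hy⟩ := hT z hz
  exact h.eq_zero_of_dominated hR hy

theorem isProf_pairProf (h : Setting t D f) (I : Finset (Fin n)) (a b : A) :
    IsProf (pairProf t I a b) := fun i => by
  unfold pairProf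
  split_ifs <;> simp [IsPref.raise, h.tie]

theorem pairProf_mem (h : Setting t D f) (I : Finset (Fin n)) {a b : A} (hab : a ≠ b) :
    pairProf t I a b ∈ D := by
  refine h.mem_of_two_top (h.isProf_pairProf I a b) hab fun i z hza hzb => ?_
  by_cases hi : i ∈ I <;> simp [pairProf, hi, raise, hza, hzb]

theorem eq_pairProb (h : Setting t D f) {R : Prof n A} (hR : R ∈ D) {I : Finset (Fin n)}
    {a b : A} (hab : a ≠ b) (hI : Weak t I a b) (hIa : ∀ i ∈ I, ∀ z, ¬ R i z a)
    (hIb : ∀ i ∉ I, R i b a) : f R a = pairProb f t I a b := by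
  let P : Prof n A := fun i => if i ∈ I then raise a (raise b t) else raise b (R i)
  have hP : IsProf P := fun i => by
    dsimp only [P]; split_ifs <;> simp [IsPref.raise, h.tie, h.isProf R hR i]
  have hmem : P ∈ D := by
    refine h.mem hP (c := b) fun z hz => ?_
    by_cases hza : z = a
    · subst hza
      refine hI.mono fun i => ?_
      by_cases hi : i ∈ I <;> simp [P, hi, raise]
    · refine (h.weak_empty z b).mono fun i => ?_
      by_cases hi : i ∈ I <;> simp [P, hi, raise, hza]
  have hQ := h.pairProf_mem I hab
  have h₁ : f R a = f P a := h.eq_of_upper hR hmem fun i z => by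
    by_cases hi : i ∈ I
    · simp [P, hi, raise, hIa i hi]
    · have := hIb i hi
      simp only [P, hi, raise, if_false]
      grind
  have h₂ : f P b = f (pairProf t I a b) b := h.eq_of_upper hmem hQ fun i z => by
    by_cases hi : i ∈ I <;> simp [P, pairProf, hi, raise]
  have h₃ := h.sum_eq_one hmem {a, b} fun z hz => ⟨b, fun i => by
    by_cases hi : i ∈ I <;> simp_all [P, raise]⟩
  have h₄ := h.sum_eq_one hQ {a, b} fun z hz => ⟨b, fun i => by
    by_cases hi : i ∈ I <;> simp_all [pairProf, raise]⟩
  rw [Finset.sum_pair hab] at h₃ h₄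
  unfold pairProb
  linarith

theorem pairProb_right (h : Setting t D f) {I : Finset (Fin n)} {a b c : A} (hab : a ≠ b)
    (hac : a ≠ c) (hbc : b ≠ c) (hIb : Weak t I a b) (hIc : Weak t I a c) :
    pairProb f t I a b = pairProb f t I a c := by
  let R : Prof n A := fun i =>
    if i ∈ I then raise a (raise b t) else raise b (raise c (raise a t))
  have hR : IsProf R := fun i => by
    dsimp only [R]; split_ifs <;> apply_rules [IsPref.raise, h.tie]
  have hmem : R ∈ D := by
    refine h.mem hR (c := b) fun z hz => ?_
    by_cases hza : z = a
    · subst hza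
      refine hIb.mono fun i => ?_
      by_cases hi : i ∈ I <;> simp [R, hi, raise]
    · refine (h.weak_empty z b).mono fun i => ?_
      by_cases hi : i ∈ I <;> simp [R, hi, raise, hza, hz]
  have htop : ∀ i ∈ I, ∀ z, ¬ R i z a := fun i hi z => by simp [R, hi, raise]
  rw [← h.eq_pairProb hmem hab hIb htop fun i hi => by simp [R, hi, raise, hab],
    ← h.eq_pairProb hmem hac hIc htop fun i hi => by simp [R, hi, raise, hab, hac]]

theorem pairProb_left (h : Setting t D f) {I : Finset (Fin n)} {a b c : A} (hab : a ≠ b)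
    (hac : a ≠ c) (hbc : b ≠ c) (hIa : Weak t I a b) (hIc : Weak t I c b) :
    pairProb f t I a b = pairProb f t I c b := by
  let R : A → A → Prof n A := fun a c i =>
    if i ∈ I then raise a (raise c (raise b t)) else raise b (raise a (raise c t))
  have hR : ∀ a c, IsProf (R a c) := fun a c i => by
    dsimp only [R]; split_ifs <;> apply_rules [IsPref.raise, h.tie]
  have key : ∀ a c, a ≠ b → Weak t I a b → Weak t I c b →
      R a c ∈ D ∧ f (R a c) b = 1 - pairProb f t I a b := by
    intro a c hab hIa hIc
    have hmem : R a c ∈ D := by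
      refine h.mem (hR a c) (c := b) fun z hz => ?_
      by_cases hzac : z = a ∨ z = c
      · have hIz : Weak t I z b := by rcases hzac with rfl | rfl <;> assumption
        refine hIz.mono fun i => ?_
        by_cases hi : i ∈ I <;> simp [R, hi, raise]
      · push Not at hzac
        refine (h.weak_empty z b).mono fun i => ?_
        by_cases hi : i ∈ I <;> simp [R, hi, raise, hzac]
    have h₁ := h.sum_eq_one hmem {a, b} fun z hz => ⟨a, fun i => by
      by_cases hi : i ∈ I <;> simp_all [R, raise]⟩
    rw [Finset.sum_pair hab, h.eq_pairProb hmem hab hIa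
      (fun i hi z => by simp [R, hi, raise]) fun i hi => by simp [R, hi, raise, hab]] at h₁
    exact ⟨hmem, by linarith⟩
  obtain ⟨hm₁, h₁⟩ := key a c hab hIa hIc
  obtain ⟨hm₂, h₂⟩ := key c a hbc.symm hIc hIa
  have h₃ : f (R a c) b = f (R c a) b := h.eq_of_upper hm₁ hm₂ fun i z => by
    by_cases hi : i ∈ I <;> simp only [R, hi, raise, if_true, if_false] <;> grind
  linarith

theorem pairProb_union (h : Setting t D f) {I J : Finset (Fin n)} {a b c : A} (hab : a ≠ b)
    (hac : a ≠ c) (hbc : b ≠ c) (hIJ : Disjoint I J) (hI : Weak t I a b) (hJ : Weak t J b a)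
    (hIJa : Weak t (I ∪ J) a c) (hIJb : Weak t (I ∪ J) b c) :
    pairProb f t (I ∪ J) a c = pairProb f t I a b + pairProb f t J b a := by
  let R : Bool → Bool → Prof n A := fun p k i =>
    if i ∈ I then raise a (raise b (raise c t))
    else if i ∈ J then
      if p then raise b (raise a (raise c t)) else raise b (raise c (raise a t))
    else if k then raise c (raise a (raise b t)) else raise c (raise b (raise a t))
  have hJI : ∀ i ∈ J, i ∉ I := fun i hi hi' => Finset.disjoint_left.1 hIJ hi' hi
  have hR : ∀ p k, IsProf (R p k) := fun p k i => by
    dsimp only [R]; split_ifs <;> apply_rules [IsPref.raise, h.tie]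
  have hmem : ∀ p k, R p k ∈ D := by
    refine fun p k => h.mem (hR p k) (c := c) fun z hz => ?_
    by_cases hzab : z = a ∨ z = b
    · have hIz : Weak t (I ∪ J) z c := by rcases hzab with rfl | rfl <;> assumption
      refine hIz.mono fun i => ?_
      by_cases hi : i ∈ I <;> by_cases hj : i ∈ J <;> cases k <;> simp [R, hi, hj, raise]
    · push Not at hzab
      refine (h.weak_empty z c).mono fun i => ?_
      by_cases hi : i ∈ I <;> by_cases hj : i ∈ J <;> cases k <;> cases p <;>
        simp [R, hi, hj, raise, hzab, hz]
  have hsum : ∀ p k, f (R p k) a + f (R p k) b + f (R p k) c = 1 := fun p k => by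
    have := h.sum_eq_one (hmem p k) {a, b, c} fun z hz => ⟨a, fun i => by
      by_cases hi : i ∈ I <;> by_cases hj : i ∈ J <;> cases k <;> cases p <;>
        simp_all [R, raise]⟩
    rw [Finset.sum_insert (by simp [hab, hac]), Finset.sum_pair hbc] at this
    linarith
  have hc : ∀ p, f (R p true) c = f (R p false) c := fun p =>
    h.eq_of_upper (hmem _ _) (hmem _ _) fun i z => by
      by_cases hi : i ∈ I <;> by_cases hj : i ∈ J <;> simp [R, hi, hj, raise]
  have hb : ∀ k, f (R true k) b = f (R false k) b := fun k =>
    h.eq_of_upper (hmem _ _) (hmem _ _) fun i z => by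
      by_cases hi : i ∈ I <;> by_cases hj : i ∈ J <;> simp [R, hi, hj, raise]
  have hIa : ∀ p k, ∀ i ∈ I, ∀ z, ¬ R p k i z a := fun p k i hi z => by simp [R, hi, raise]
  have hIc : Weak t I a c := hIJa.mono Finset.subset_union_left
  have h00 : f (R false false) a = pairProb f t I a c :=
    h.eq_pairProb (hmem _ _) hac hIc (hIa _ _) fun i hi => by
      by_cases hj : i ∈ J <;> simp [R, hi, hj, raise, hab, hac]
  have h01 : f (R false true) a = pairProb f t I a c :=
    h.eq_pairProb (hmem _ _) hac hIc (hIa _ _) fun i hi => by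
      by_cases hj : i ∈ J <;> simp [R, hi, hj, raise, hab, hac]
  have h10 : f (R true false) a = pairProb f t I a b :=
    h.eq_pairProb (hmem _ _) hab hI (hIa _ _) fun i hi => by
      by_cases hj : i ∈ J <;> simp [R, hi, hj, raise, hab, hac]
  have h11 : f (R true true) b = pairProb f t J b a :=
    h.eq_pairProb (hmem _ _) hab.symm hJ
      (fun i hi z => by simp [R, hi, hJI i hi, raise]) fun i hj => by
      by_cases hi : i ∈ I <;> simp [R, hi, hj, raise, hab.symm, hbc]
  have h11c : f (R true true) c = 1 - pairProb f t (I ∪ J) a c := by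
    let Q : Prof n A := fun i =>
      if i ∈ I ∨ i ∈ J then raise a (raise b (raise c t)) else raise c (raise a (raise b t))
    have hQ : IsProf Q := fun i => by
      dsimp only [Q]; split_ifs <;> apply_rules [IsPref.raise, h.tie]
    have hw : Wins t Q c := by
      intro z hz
      by_cases hzab : z = a ∨ z = b
      · have hIz : Weak t (I ∪ J) z c := by rcases hzab with rfl | rfl <;> assumption
        refine hIz.mono fun i => ?_
        by_cases hi : i ∈ I ∨ i ∈ J <;> simp [Q, hi, raise]
      · push Not at hzab
        refine (h.weak_empty z c).mono fun i => ?_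
        by_cases hi : i ∈ I ∨ i ∈ J <;> simp [Q, hi, raise, hzab]
    have hmQ := h.mem hQ hw
    have h₁ := h.sum_eq_one hmQ {a, c} fun z hz => ⟨a, fun i => by
      have hz : z ≠ a ∧ z ≠ c := by simpa using hz
      by_cases hi : i ∈ I ∨ i ∈ J <;> simp [Q, hi, raise, hz, hac]⟩
    rw [Finset.sum_pair hac, h.eq_pairProb hmQ hac hIJa
      (fun i hi z => by simp [Q, Finset.mem_union.1 hi, raise])
      fun i hi => by
        have hi' : ¬(i ∈ I ∨ i ∈ J) := fun h' => hi (Finset.mem_union.2 h')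
        simp only [Q, hi', if_false, raise]
        simp [hac]] at h₁
    have h₂ : f (R true true) c = f Q c := h.eq_of_upper (hmem _ _) hmQ fun i z => by
      by_cases hi : i ∈ I <;> by_cases hj : i ∈ J <;>
        simp only [R, Q, hi, hj, raise, if_true, if_false, or_true, or_false] <;> grind
    linarith
  linarith [hsum true true, hsum true false, hsum false true, hsum false false, hc true,
    hc false, hb true, hb false]

theorem pairProb_empty (h : Setting t D f) {a b : A} (hab : a ≠ b) :
    pairProb f t ∅ a b = 0 :=
  h.eq_zero_of_dominated (h.pairProf_mem ∅ hab) (x := b) fun i => by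
    simp [pairProf, raise, hab]

theorem exists_third (h : Setting t D f) (a b : A) : ∃ c, a ≠ c ∧ b ≠ c := by
  have h₁ : #({a, b} : Finset A) < Fintype.card A :=
    lt_of_le_of_lt Finset.card_le_two h.three_le
  obtain ⟨c, hc⟩ := Finset.exists_mem_notMem_of_card_lt_card (s := {a, b}) (t := univ)
    (by simpa using h₁)
  refine ⟨c, ?_, ?_⟩ <;> rintro rfl <;> simp at hc

theorem pairProb_const (h : Setting t D f) {I : Finset (Fin n)} (hI : 2 * #I < n)
    {a b a' b' : A} (hab : a ≠ b) (hab' : a' ≠ b') :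
    pairProb f t I a b = pairProb f t I a' b' := by
  have hW : ∀ x y, Weak t I x y := fun _ _ => Or.inl hI
  have right : ∀ {x y z}, x ≠ y → x ≠ z → pairProb f t I x y = pairProb f t I x z := by
    intro x y z hxy hxz
    by_cases hyz : y = z
    · rw [hyz]
    · exact h.pairProb_right hxy hxz hyz (hW _ _) (hW _ _)
  have left : ∀ {x y z}, x ≠ y → z ≠ y → pairProb f t I x y = pairProb f t I z y := by
    intro x y z hxy hzy
    by_cases hxz : x = z
    · rw [hxz]
    · exact h.pairProb_left hxy hxz hzy.symm (hW _ _) (hW _ _)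
  obtain ⟨c, hac, hac'⟩ := h.exists_third a a'
  exact (right hab hac).trans ((left hac hac').trans (right hac' hab'))

theorem exists_weights (h : Setting t D f) : ∃ γ : Fin n → ℝ, (∀ i, 0 ≤ γ i) ∧
    ∀ (I : Finset (Fin n)) (a b : A), a ≠ b → Weak t I a b →
      pairProb f t I a b = ∑ i ∈ I, γ i := by
  have h4 := h.four_le
  obtain ⟨a₀, b₀, hab₀⟩ : ∃ a b : A, a ≠ b := by
    have := h.three_le
    have : 1 < Fintype.card A := by omega
    exact Fintype.one_lt_card_iff.1 this
  refine ⟨fun i => pairProb f t {i} a₀ b₀,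
    fun i => (h.sds _ (h.pairProf_mem {i} hab₀)).1 _, ?_⟩
  have single : ∀ (i : Fin n) (a b : A), a ≠ b →
      pairProb f t {i} a b = pairProb f t {i} a₀ b₀ := fun i a b hab =>
    h.pairProb_const (by simp; omega) hab hab₀
  have small : ∀ (I : Finset (Fin n)), 2 * #I < n → ∀ a b : A, a ≠ b →
      pairProb f t I a b = ∑ i ∈ I, pairProb f t {i} a₀ b₀ := by
    intro I
    induction I using Finset.induction_on with
    | empty => intro _ a b hab; simpa using h.pairProb_empty hab
    | insert i s hi ih =>
      intro hn a b hab
      rw [Finset.card_insert_of_notMem hi] at hn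
      obtain ⟨c, hac, hbc⟩ := h.exists_third a b
      have hcard : 2 * #({i} ∪ s) < n := by
        rw [← Finset.insert_eq, Finset.card_insert_of_notMem hi]
        exact hn
      rw [Finset.sum_insert hi, Finset.insert_eq,
        h.pairProb_union hac hab hbc.symm (by simpa using hi) (Or.inl (by simp; omega))
          (Or.inl (by omega)) (Or.inl hcard) (Or.inl hcard),
        single i a c hac, ih (by omega) c a hac.symm]
  rintro I a b hab (hI | ⟨hI, hba⟩)
  · exact small I hI a b hab
  · obtain ⟨i, hi⟩ : I.Nonempty := Finset.card_pos.1 (by omega)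
    have hcard := Finset.card_erase_add_one hi
    have tied : ∀ {b c}, a ≠ b → a ≠ c → b ≠ c → t b a → t b c →
        pairProb f t I a b = ∑ i ∈ I, pairProb f t {i} a₀ b₀ := by
      intro b c hab hac hbc hba hbc'
      have hu : {i} ∪ I.erase i = I := by rw [← Finset.insert_eq, Finset.insert_erase hi]
      have key := h.pairProb_union (I := {i}) (J := I.erase i) hac hab hbc.symm (by simp)
        (Or.inl (by simp; omega)) (Or.inl (by omega)) (by rw [hu]; exact Or.inr ⟨hI, hba⟩)
        (by rw [hu]; exact Or.inr ⟨hI, hbc'⟩)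
      rw [hu] at key
      rw [key, single i a c hac, small _ (by omega) c a hac.symm]
      exact Finset.add_sum_erase I (fun i => pairProb f t {i} a₀ b₀) hi
    obtain ⟨c, hac, hbc⟩ := h.exists_third a b
    rcases h.tie.1 b c hbc with h' | h'
    · exact tied hab hac hbc hba h'
    · have hca := h.tie.2.1 _ _ _ h' hba
      rw [h.pairProb_right hab hac hbc (Or.inr ⟨hI, hba⟩) (Or.inr ⟨hI, hca⟩)]
      exact tied hac hab hbc.symm hca h'

theorem le_prob_of_weights (h : Setting t D f) {γ : Fin n → ℝ}
    (hγ : ∀ (I : Finset (Fin n)) (a b : A), a ≠ b → Weak t I a b →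
      pairProb f t I a b = ∑ i ∈ I, γ i)
    {R : Prof n A} (hR : IsProf R) {c x : A} (hc : Wins t R c) (hxc : x ≠ c) :
    ∑ i, γ i * dict i R x ≤ f R x := by
  let I : Finset (Fin n) := {i | TopRanked (R i) x}
  have hI : ∀ i, i ∈ I ↔ ∀ y, ¬ R i y x := fun i => by simp [I, (hR i).topRanked_iff]
  let R' : Prof n A := fun i => if i ∈ I then R i else lower x (R i)
  have hR' : IsProf R' := fun i => by
    dsimp only [R']
    split_ifs
    exacts [hR i, (hR i).lower x]
  have hc' : ∀ i z, z ≠ c → R' i z c → R i z c := fun i z _ => by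
    by_cases hi : i ∈ I
    · simp [R', hi]
    · simp only [R', hi, lower, if_false]
      grind
  have hwI : Weak t I x c := (hc x hxc).mono fun i hi => by
    simpa using ((hR i).not_iff hxc.symm).1 ((hI i).1 hi c)
  rw [sum_mul_dict, ← hγ I x c hxc hwI,
    ← h.eq_pairProb (h.mem hR' (hc.of_imp hc')) hxc hwI (fun i hi z => by
      simpa [R', hi] using (hI i).1 hi z) fun i hi => by simp [R', hi, lower, hxc.symm]]
  refine h.mono (fun S => ?_) fun i y z hy hz => ?_
  · rw [← compl_compl S, hybrid_compl]
    exact h.mem (hR.hybrid hR' _) (hc.hybrid hc' _)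
  · by_cases hi : i ∈ I
    · exact absurd hy ((hI i).1 hi y)
    · simp only [R', hi, lower, if_false] at hz
      rcases hz.2 with rfl | hz
      · exact absurd hy ((hR i).irrefl _)
      · exact (hR i).2.1 _ _ _ hz hy

theorem eq_of_wins (h : Setting t D f) {γ : Fin n → ℝ}
    (hγ : ∀ (I : Finset (Fin n)) (a b : A), a ≠ b → Weak t I a b →
      pairProb f t I a b = ∑ i ∈ I, γ i)
    {R : Prof n A} (hR : IsProf R) {c x : A} (hc : Wins t R c) (hxc : x ≠ c) :
    f R x = ∑ i, γ i * dict i R x := by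
  refine le_antisymm ?_ (h.le_prob_of_weights hγ hR hc hxc)
  have : Nonempty A := ⟨x⟩
  choose tp htp using fun i => (hR i).exists_topRanked
  have htp' := fun i => (hR i).topRanked_iff.1 (htp i)
  have hne := fun i => (hR i).not_iff hxc.symm
  let R' : Prof n A := fun i =>
    if R i c x then raise c (R i) else raise (tp i) (raise x (raise c (R i)))
  have hR' : IsProf R' := fun i => by
    dsimp only [R']; split_ifs <;> apply_rules [IsPref.raise]
  have htpc : ∀ i, ¬ R i c x → tp i ≠ c := fun i hi heq =>
    htp' i x (heq ▸ (hne i).1 hi)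
  have hc' : ∀ i z, z ≠ c → R' i z c → R i z c := fun i z hz => by
    by_cases hi : R i c x
    · simp [R', hi, raise]
    · have h₁ := htp i c (htpc i hi).symm
      have h₂ := (hne i).1 hi
      simp only [R', hi, raise, if_false]
      grind
  have hw' : Wins t R' c := hc.of_imp hc'
  have hmem' := h.mem hR' hw'
  have hle : f R x ≤ f R' x := by
    refine h.mono (fun S => h.mem (hR.hybrid hR' S) (hc.hybrid hc' S)) fun i y z => ?_
    by_cases hi : R i c x
    · simp only [R', hi, raise, if_true]
      have := (hR i).2.1 z y x
      have := (hR i).irrefl x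
      grind
    · simp only [R', hi, raise, if_false]
      have := htp' i z
      grind
  have htop : ∀ i, TopRanked (R' i) x ↔ TopRanked (R i) x := fun i => by
    rw [(hR' i).topRanked_iff, (hR i).topRanked_iff]
    by_cases hi : R i c x
    · refine ⟨fun h' => absurd ?_ (h' c), fun h' => absurd hi (h' c)⟩
      simp [R', hi, raise, hxc]
    · simp only [R', hi, raise, if_false]
      have h₁ := htp i x
      have h₂ := htp' i
      grind
  have hprob : f R' c = 1 - ∑ i ∈ {i | ¬ R i c x}, γ i := by
    let Q : Prof n A := fun i =>
      if R i c x then raise c (raise x t) else raise x (raise (tp i) (raise c t))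
    have hQ : IsProf Q := fun i => by
      dsimp only [Q]; split_ifs <;> apply_rules [IsPref.raise, h.tie]
    have hQR : ∀ i z, Q i z c ↔ R' i z c := fun i z => by
      by_cases hi : R i c x
      · simp [Q, R', hi, raise]
      · have := htpc i hi
        simp only [Q, R', hi, raise, if_false]
        grind
    have hmQ := h.mem hQ (hw'.of_imp fun i z _ => (hQR i z).1)
    have hwI : Weak t {i | ¬ R i c x} x c := (hc x hxc).mono fun i => by simp [hne]
    have h₁ := h.sum_eq_one hmQ {x, c} fun z hz => ⟨x, fun i => by
      have hz : z ≠ x ∧ z ≠ c := by simpa using hz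
      by_cases hi : R i c x <;> simp [Q, hi, raise, hz]⟩
    rw [Finset.sum_pair hxc, h.eq_pairProb hmQ hxc hwI
      (fun i hi z => by
        have hi : ¬ R i c x := by simpa using hi
        simp [Q, hi, raise])
      (fun i hi => by
        have hi : R i c x := by simpa using hi
        simp [Q, hi, raise, hxc]), hγ _ _ _ hxc hwI] at h₁
    rw [h.eq_of_upper hmem' hmQ fun i z => (hQR i z).symm]
    linarith
  have hdict : ∑ i, γ i * dict i R' c = ∑ i, γ i - ∑ i ∈ {i | ¬ R i c x}, γ i := by
    rw [sum_mul_dict, ← Finset.sum_filter_add_sum_filter_not univ (fun i => R i c x) γ,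
      add_sub_cancel_right]
    refine Finset.sum_congr (Finset.filter_congr fun i _ => ?_) fun _ _ => rfl
    rw [(hR' i).topRanked_iff]
    by_cases hi : R i c x
    · simp [R', hi, raise]
    · refine ⟨fun h' => absurd ?_ (h' (tp i)), fun h' => absurd h' hi⟩
      simp [R', hi, raise, (htpc i hi).symm]
  have hz : ∑ z ∈ univ.erase c, (f R' z - ∑ i, γ i * dict i R' z) = 0 := by
    have h₁ := (h.sds R' hmem').2
    have h₂ := sum_sum_mul_dict γ hR'
    rw [← Finset.sum_erase_add _ _ (mem_univ c)] at h₁ h₂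
    rw [Finset.sum_sub_distrib]
    linarith
  have hx := (Finset.sum_eq_zero_iff_of_nonneg fun z hz =>
    sub_nonneg.2 (h.le_prob_of_weights hγ hR' hw' (Finset.ne_of_mem_erase hz))).1 hz x
    (by simp [hxc])
  have hxx : ∑ i, γ i * dict i R' x = ∑ i, γ i * dict i R x := by
    simp only [dict, htop]
  linarith

theorem eq_of_not_wins (h : Setting t D f) {γ : Fin n → ℝ}
    (hγ : ∀ (I : Finset (Fin n)) (a b : A), a ≠ b → Weak t I a b →
      pairProb f t I a b = ∑ i ∈ I, γ i)
    {R : Prof n A} (hR : R ∈ D) {x : A} (hx : ¬ Wins t R x) :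
    f R x = ∑ i, γ i * dict i R x := by
  have hRp := h.isProf R hR
  obtain ⟨R', hR', ⟨c, hc⟩, hup⟩ := exists_wins_same_upper h.tie hRp x
  have hxc : x ≠ c := by
    rintro rfl
    exact hx (hc.of_imp fun i z _ => (hup i z).2)
  rw [h.eq_of_upper hR (h.mem hR' hc) fun i y => (hup i y).symm, h.eq_of_wins hγ hR' hc hxc]
  simp only [dict, (hRp _).topRanked_iff, (hR' _).topRanked_iff, hup]

theorem exists_random_dictatorship (h : Setting t D f) (hD : ¬ D ⊆ TieCondorcetDomain n t) :
    ∃ γ : Fin n → ℝ, (∀ i, 0 ≤ γ i) ∧ ∑ i, γ i = 1 ∧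
      ∀ R ∈ D, ∀ x, f R x = ∑ i, γ i * dict i R x := by
  have : Nonempty A := Fintype.card_pos_iff.1 (by have := h.three_le; omega)
  obtain ⟨γ, hγ0, hγ⟩ := h.exists_weights
  have hsum : ∑ i, γ i = 1 := by
    obtain ⟨R, hR, hRC⟩ := Set.not_subset.1 hD
    rw [← sum_sum_mul_dict γ (h.isProf R hR), ← (h.sds R hR).2]
    refine Finset.sum_congr rfl fun x _ => (h.eq_of_not_wins hγ hR fun hx => hRC ?_).symm
    exact ⟨h.isProf R hR, x, (wins_iff h.even h.tie (h.isProf R hR) x).2 hx⟩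
  refine ⟨γ, hγ0, hsum, fun R hR x => ?_⟩
  by_cases hx : Wins t R x
  · have h₁ := (h.sds R hR).2
    have h₂ := sum_sum_mul_dict γ (h.isProf R hR)
    rw [← Finset.sum_erase_add _ _ (mem_univ x)] at h₁ h₂
    rw [Finset.sum_congr rfl fun z hz => h.eq_of_not_wins hγ hR fun hz' =>
      Finset.ne_of_mem_erase hz (hx.unique h.tie (h.isProf R hR) hz')] at h₁
    linarith
  · exact h.eq_of_not_wins hγ hR hx

end Setting

section RandomDictatorship

variable {n : ℕ} {A : Type*} [Fintype A]

theorem mass_sum_mul_dict (γ : Fin n → ℝ) (R : Prof n A) (S : Set A) :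
    mass (fun x => ∑ i, γ i * dict i R x) S = ∑ i, γ i * mass (dict i R) S := by
  simp only [mass, Finset.mul_sum]
  rw [Finset.sum_comm]
  refine Finset.sum_congr rfl fun y _ => ?_
  by_cases hy : y ∈ S <;> simp [hy]

theorem mass_dict_le [Nonempty A] {R : Prof n A} (hR : IsProf R) (i : Fin n) (S : Set A) :
    mass (dict i R) S ≤ 1 := by
  rw [← sum_dict hR i]
  refine Finset.sum_le_sum fun y _ => Set.indicator_le_self' (fun z _ => ?_) y
  unfold dict
  split_ifs <;> norm_num

theorem mass_dict_UC [Nonempty A] {R : Prof n A} (hR : IsProf R) (i : Fin n) (x : A) :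
    mass (dict i R) (UC (R i) x) = 1 := by
  rw [← sum_dict hR i]
  refine Finset.sum_congr rfl fun y _ => ?_
  by_cases hy : y ∈ UC (R i) x
  · simp [hy]
  · have : ¬ TopRanked (R i) y := fun h => hy <| by
      by_cases hyx : x = y
      · exact Or.inr hyx.symm
      · exact Or.inl (h x hyx)
    simp [hy, dict, this]

theorem strategyproof_of_random_dictatorship [Nonempty A] {D : Set (Prof n A)}
    (hD : ∀ R ∈ D, IsProf R) {f : Prof n A → A → ℝ} {γ : Fin n → ℝ} (hγ : ∀ i, 0 ≤ γ i)
    (hf : ∀ R ∈ D, ∀ x, f R x = ∑ i, γ i * dict i R x) : Strategyproof D f := by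
  intro R hR R' hR' i hi x
  rw [funext (hf R hR), funext (hf R' hR'), mass_sum_mul_dict, mass_sum_mul_dict]
  refine Finset.sum_le_sum fun j _ => mul_le_mul_of_nonneg_left ?_ (hγ j)
  by_cases hj : j = i
  · subst hj
    rw [mass_dict_UC (hD R hR)]
    exact mass_dict_le (hD R' hR') _ _
  · refine le_of_eq ?_
    unfold dict
    rw [hi j hj]

theorem nonImposing_of_random_dictatorship (hn : 4 ≤ n) (heven : Even n) {t : A → A → Prop}
    (ht : IsPref t) {D : Set (Prof n A)} (hD : TieCondorcetDomain n t ⊆ D)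
    {f : Prof n A → A → ℝ} {γ : Fin n → ℝ} (hγ : ∑ i, γ i = 1)
    (hf : ∀ R ∈ D, ∀ x, f R x = ∑ i, γ i * dict i R x) : NonImposing D f := by
  intro x
  have hR : IsProf fun _ : Fin n => raise x t := fun _ => ht.raise x
  have hmem : (fun _ : Fin n => raise x t) ∈ D := by
    refine hD ⟨hR, x, (wins_iff heven ht hR x).2 fun z _ => Or.inl ?_⟩
    simp [raise]
    omega
  have htop : TopRanked (raise x t) x := fun y hy => ⟨hy, Or.inl rfl⟩
  exact ⟨_, hmem, by simp [hf _ hmem, dict, htop, hγ]⟩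

end RandomDictatorship

/-- For even `n ≥ 4` and a connected domain `D ⊋ D_C^▷`, an SDS on `D` is
strategyproof and non-imposing iff it is a random dictatorship. -/
theorem sds_superTieCondorcet_random_dictatorship {n : ℕ} {A : Type*} [Fintype A]
    (hn : 4 ≤ n) (heven : Even n) (hA : 3 ≤ Fintype.card A)
    (t : A → A → Prop) (ht : IsPref t)
    (D : Set (Prof n A)) (hDprof : ∀ R ∈ D, IsProf R)
    (hDC : TieCondorcetDomain n t ⊂ D) (hconn : Connected D)
    (f : Prof n A → A → ℝ) (hf : IsSDS D f) :
    (Strategyproof D f ∧ NonImposing D f) ↔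
      (∃ γ : Fin n → ℝ, (∀ i, 0 ≤ γ i) ∧ ∑ i, γ i = 1 ∧
        ∀ R ∈ D, ∀ x, f R x = ∑ i, γ i * dict i R x) := by
  have : Nonempty A := Fintype.card_pos_iff.1 (by omega)
  constructor
  · rintro ⟨hsp, hni⟩
    exact (Setting.mk hn heven hA ht hDprof hDC.1 hconn hf hsp hni).exists_random_dictatorship
      hDC.2
  · rintro ⟨γ, hγ0, hγ1, hγ⟩
    exact ⟨strategyproof_of_random_dictatorship hDprof hγ0 hγ,
      nonImposing_of_random_dictatorship hn heven ht hDC.1 hγ1 hγ⟩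
end

section
/- The Condorcet rule COND is group-strategyproof on the Condorcet domain D_C: for all profiles R, R' ∈ D_C and every nonempty set of voters I with ≻_j = ≻'_j for all j ∉ I, there is a voter i ∈ I such that COND(R) ≿^SD_i COND(R'). -/
open scoped Classical
open Finset

/-- Swapping the two alternatives negates the majority margin. -/
theorem margin_swap {n : ℕ} {A : Type*} (R : Prof n A) (x y : A) :
    margin R y x = -margin R x y := by
  simp [margin]

/-- The majority margin is monotone in the set of supporters and antitone in the set of
opponents. -/
theorem margin_mono {n : ℕ} {A : Type*} {R R' : Prof n A} {x y : A}
    (hxy : ∀ i, R i x y → R' i x y) (hyx : ∀ i, R' i y x → R i y x) :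
    margin R x y ≤ margin R' x y := by
  have h₁ : Nat.card {i : Fin n // R i x y} ≤ Nat.card {i : Fin n // R' i x y} :=
    Nat.card_le_card_of_injective _ (Subtype.map_injective hxy Function.injective_id)
  have h₂ : Nat.card {i : Fin n // R' i y x} ≤ Nat.card {i : Fin n // R i y x} :=
    Nat.card_le_card_of_injective _ (Subtype.map_injective hyx Function.injective_id)
  unfold margin
  omega

theorem CondorcetWinner.eq {n : ℕ} {A : Type*} {R : Prof n A} {x y : A}
    (hx : CondorcetWinner R x) (hy : CondorcetWinner R y) : x = y := by
  by_contra hne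
  have h₁ := hx y (Ne.symm hne)
  have h₂ := hy x hne
  rw [margin_swap] at h₂
  omega

theorem CondorcetWinner.mass_condRule {n : ℕ} {A : Type*} [Fintype A] {R : Prof n A} {x : A}
    (hx : CondorcetWinner R x) (S : Set A) :
    mass (CondRule R) S = if x ∈ S then 1 else 0 := by
  have h : ∀ y, S.indicator (CondRule R) y = if y = x then (if x ∈ S then 1 else 0) else 0 := by
    intro y
    by_cases hy : y = x
    · subst hy
      simp [Set.indicator_apply, CondRule, hx]
    · have hn : ¬ CondorcetWinner R y := fun h => hy (h.eq hx)
      simp [CondRule, hn, hy]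
  simp [mass, h]

/-- A voter who weakly prefers the Condorcet winner of `R` to that of `R'` also prefers the
corresponding degenerate lotteries in the sense of stochastic dominance. -/
theorem CondorcetWinner.sdDom_condRule {n : ℕ} {A : Type*} [Fintype A] {R R' : Prof n A}
    {x y : A} {r : A → A → Prop} (hr : IsPref r) (hx : CondorcetWinner R x)
    (hy : CondorcetWinner R' y) (hxy : x ∈ UC r y) :
    SDdom r (CondRule R) (CondRule R') := by
  intro z
  rw [hx.mass_condRule, hy.mass_condRule]
  by_cases hyz : y ∈ UC r z
  · have hxz : x ∈ UC r z := by
      rcases hxy with hxy | rfl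
      · rcases hyz with hyz | rfl
        · exact Or.inl (hr.2.1 _ _ _ hxy hyz)
        · exact Or.inl hxy
      · exact hyz
    simp [hxz, hyz]
  · rw [if_neg hyz]
    split_ifs <;> norm_num

/-- The Condorcet rule is group-strategyproof on the Condorcet domain. -/
theorem condRule_groupStrategyproof {n : ℕ} {A : Type*} [Fintype A]
    (hn : 3 ≤ n) (hA : 3 ≤ Fintype.card A) :
    GroupStrategyproof (CondorcetDomain n A) (CondRule (n := n) (A := A)) := by
  rintro R ⟨hR, x, hx⟩ R' ⟨-, y, hy⟩ I ⟨i₀, hi₀⟩ hI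
  by_contra! hcon
  have hpref : ∀ i ∈ I, x ∉ UC (R i) y := fun i hi hxy =>
    hcon i hi (hx.sdDom_condRule (hR i) hy hxy)
  have hne : x ≠ y := fun h => hpref i₀ hi₀ (Or.inr h)
  have hle : margin R x y ≤ margin R' x y := by
    refine margin_mono (fun i h => ?_) (fun i h => ?_)
    · rwa [← hI i fun hi => hpref i hi (Or.inl h)]
    · by_cases hi : i ∈ I
      · exact ((hR i).1 x y hne).resolve_left fun h' => hpref i hi (Or.inl h')
      · rwa [hI i hi]
  have h₁ := hx y hne.symm
  have h₂ := hy x hne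
  rw [margin_swap] at h₂
  omega
end

section
/- Every group-strategyproof and non-imposing SDS f on an arbitrary domain D is ex post efficient: if some alternative y is Pareto-dominated in a profile R ∈ D, then f(R,y) = 0. -/
open scoped Classical
open Finset

lemma le_mass {A : Type*} [Fintype A] {p : A → ℝ} (hp : ∀ x, 0 ≤ p x) {S : Set A} {x : A}
    (hx : x ∈ S) : p x ≤ mass p S := by
  have h := Finset.single_le_sum (f := S.indicator p)
    (fun y _ => Set.indicator_nonneg (fun z _ => hp z) y) (Finset.mem_univ x)
  rwa [Set.indicator_of_mem hx] at h

lemma mass_add_le_sum {A : Type*} [Fintype A] {p : A → ℝ} (hp : ∀ x, 0 ≤ p x) {S : Set A} {y : A}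
    (hy : y ∉ S) : mass p S + p y ≤ ∑ x, p x := by
  have h : p y ≤ ∑ x, (p x - S.indicator p x) := by
    have h := Finset.single_le_sum (f := fun x => p x - S.indicator p x)
      (fun z _ => sub_nonneg.2 (Set.indicator_le_self' (fun w _ => hp w) z)) (Finset.mem_univ y)
    simpa only [Set.indicator_of_notMem hy, sub_zero] using h
  rw [Finset.sum_sub_distrib] at h
  unfold mass
  linarith

/-- Every group-strategyproof and non-imposing SDS on an arbitrary domain is
ex post efficient. -/
theorem groupStrategyproof_nonImposing_expost {n : ℕ} {A : Type*} [Fintype A]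
    (hn : 3 ≤ n) (hA : 3 ≤ Fintype.card A)
    (D : Set (Prof n A)) (hDprof : ∀ R ∈ D, IsProf R)
    (f : Prof n A → A → ℝ) (hf : IsSDS D f)
    (hgsp : GroupStrategyproof D f) (hni : NonImposing D f) :
    ExPostEfficient D f := by
  intro R hR x y hxy
  obtain ⟨R', hR', hx⟩ := hni x
  obtain ⟨i, -, hi⟩ := hgsp R hR R' hR' Finset.univ ⟨⟨0, by omega⟩, Finset.mem_univ _⟩
    (fun j hj => absurd (Finset.mem_univ j) hj)
  have hasymm := (hDprof R hR i).2.2 x y (hxy i)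
  have hy : y ∉ UC (R i) x := by
    rintro (h | rfl)
    · exact hasymm h
    · exact hasymm (hxy i)
  have hmass := le_mass (hf R' hR').1 (show x ∈ UC (R i) x from Or.inr rfl)
  have hsum := mass_add_le_sum (hf R hR).1 hy
  rw [hx] at hmass
  rw [(hf R hR).2] at hsum
  linarith [hi x, (hf R hR).1 y]
end
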